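/- Let 𝒞 and 𝒮 be finite types, H and Z arbitrary types, f : 𝒞 × 𝒮 → H, g : H → Z, and let G be a connected simple graph on 𝒮. Let (Ω, P) be a probability space carrying random variables C : Ω → 𝒞 and S : Ω → 𝒮. Assume: (i) alignment — for every c ∈ 𝒞 and every pair of G-adjacent styles s, s' ∈ 𝒮, g(f(c,s)) = g(f(c,s')); and (ii) uniformity attained — the Shannon entropy of the representation equals that of the intent, H[g ∘ f ∘ (C, S)] = H[C], where (g ∘ f ∘ (C,S))(ω) = g(f(C(ω), S(ω))). Then there exists ψ : 𝒞 → Z such that g(f(c,s)) = ψ(c) for all c ∈ 𝒞, s ∈ 𝒮, with ψ injective on the support of C; consequently there exists a recovery map r : Z → 𝒞 such that r(g(f(C(ω), S(ω)))) = C(ω) for every ω with P(C = C(ω)) > 0, i.e., the latent intent is identifiable from the learned representation up to an invertible transformation. -/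

import Mathlib

open MeasureTheory

/-- The Shannon entropy `H[X] = −∑ₓ P(X = x) log P(X = x)` of a random
variable `X : Ω → α` (the sum has only finitely many nonzero terms when `X`
takes finitely many values, since `negMulLog 0 = 0`). -/
noncomputable def shannonEntropy {Ω : Type*} [MeasurableSpace Ω]
    (P : Measure Ω) {α : Type*} (X : Ω → α) : ℝ :=
  ∑' a : α, Real.negMulLog (P (X ⁻¹' {a})).toReal

/-- **Theorem 1 (Identifiability of Latent Intent).**
Under (i) alignment (the probe output agrees on `G`-adjacent styles, with `G`
a connected augmentation graph) and (ii) attained uniformity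
(`H[g ∘ f ∘ (C, S)] = H[C]`), there is `ψ : 𝒞 → Z` with
`g (f (c, s)) = ψ c` for all `c, s`, `ψ` is injective on the support of `C`,
and there is a recovery map `r : Z → 𝒞` with `r (g (f (C ω, S ω))) = C ω`
for every `ω` whose intent has positive probability. -/
theorem identifiability_of_latent_intent
    {𝒞 𝒮 H Z : Type*} [Fintype 𝒞] [Fintype 𝒮]
    (f : 𝒞 × 𝒮 → H) (g : H → Z)
    (G : SimpleGraph 𝒮) (hconn : G.Connected)
    {Ω : Type*} [MeasurableSpace Ω] (P : Measure Ω) [IsProbabilityMeasure P]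
    (C : Ω → 𝒞) (S : Ω → 𝒮)
    (hC : ∀ c : 𝒞, MeasurableSet (C ⁻¹' {c}))
    (halign : ∀ (c : 𝒞) (s s' : 𝒮), G.Adj s s' → g (f (c, s)) = g (f (c, s')))
    (hunif : shannonEntropy P (fun ω => g (f (C ω, S ω))) = shannonEntropy P C) :
    ∃ ψ : 𝒞 → Z,
      (∀ (c : 𝒞) (s : 𝒮), g (f (c, s)) = ψ c) ∧
      (∀ c₁ c₂ : 𝒞, 0 < P (C ⁻¹' {c₁}) → 0 < P (C ⁻¹' {c₂}) →
        ψ c₁ = ψ c₂ → c₁ = c₂) ∧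
      ∃ r : Z → 𝒞, ∀ ω : Ω, 0 < P (C ⁻¹' {C ω}) →
        r (g (f (C ω, S ω))) = C ω := by
  classical
  obtain ⟨s0⟩ := hconn.nonempty
  have hψ : ∀ (c : 𝒞) (s : 𝒮), g (f (c, s)) = g (f (c, s0)) := by
    intro c s
    obtain ⟨w⟩ := hconn.preconnected s s0
    induction w with
    | nil => rfl
    | cons h _ ih => exact (halign c _ _ h).trans ih
  obtain ⟨ψ, hψd⟩ : ∃ ψ : 𝒞 → Z, ∀ c s, g (f (c, s)) = ψ c :=
    ⟨fun c => g (f (c, s0)), hψ⟩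
  have hinj : ∀ c₁ c₂ : 𝒞, 0 < P (C ⁻¹' {c₁}) → 0 < P (C ⁻¹' {c₂}) →
        ψ c₁ = ψ c₂ → c₁ = c₂ := by
    intro c₁ c₂ h1 h2 h12
    by_contra hne
    obtain ⟨p, hp⟩ : ∃ p : 𝒞 → ℝ, ∀ c, p c = (P (C ⁻¹' {c})).toReal := ⟨_, fun _ => rfl⟩
    have hp0 : ∀ c, 0 ≤ p c := fun c => by rw [hp]; exact ENNReal.toReal_nonneg
    have hp1 : 0 < p c₁ := by
      rw [hp]; exact ENNReal.toReal_pos h1.ne' (measure_ne_top _ _)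
    have hp2 : 0 < p c₂ := by
      rw [hp]; exact ENNReal.toReal_pos h2.ne' (measure_ne_top _ _)
    obtain ⟨q, hq⟩ : ∃ q : Z → ℝ, ∀ z, q z = ∑ c with ψ c = z, p c := ⟨_, fun _ => rfl⟩
    have hPq : ∀ z, (P ((fun ω => g (f (C ω, S ω))) ⁻¹' {z})).toReal = q z := by
      intro z
      have hset : (fun ω => g (f (C ω, S ω))) ⁻¹' {z}
          = ⋃ c ∈ Finset.univ.filter (fun c => ψ c = z), C ⁻¹' {c} := by
        ext ω
        simp [hψd]
      rw [hset, measure_biUnion_finset _ (fun c _ => hC c),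
        ENNReal.toReal_sum (fun c _ => measure_ne_top _ _), hq]
      · exact Finset.sum_congr rfl fun c _ => (hp c).symm
      · intro a _ b _ hab
        exact Disjoint.preimage _ (by simpa using hab)
    have hH1 : shannonEntropy P (fun ω => g (f (C ω, S ω)))
        = ∑ c, -(p c * Real.log (q (ψ c))) := by
      unfold shannonEntropy
      simp only [hPq]
      rw [tsum_eq_sum (s := Finset.univ.image ψ),
        ← Finset.sum_fiberwise_of_maps_to (s := Finset.univ) (t := Finset.univ.image ψ) (g := ψ)
          (fun c _ => Finset.mem_image_of_mem _ (Finset.mem_univ c))]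
      · refine Finset.sum_congr rfl fun z _ => ?_
        rw [Real.negMulLog, neg_mul]
        nth_rewrite 1 [hq]
        rw [Finset.sum_mul, ← Finset.sum_neg_distrib]
        refine Finset.sum_congr rfl fun c hc => ?_
        rw [(Finset.mem_filter.1 hc).2]
      · intro z hz
        have : q z = 0 := by
          rw [hq]
          refine Finset.sum_eq_zero fun c hc => ?_
          exact absurd (Finset.mem_image.2 ⟨c, Finset.mem_univ c, (Finset.mem_filter.1 hc).2⟩) hz
        simp [this]
    have hH2 : shannonEntropy P C = ∑ c, -(p c * Real.log (p c)) := by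
      unfold shannonEntropy
      rw [tsum_fintype]
      refine Finset.sum_congr rfl fun c _ => ?_
      rw [← hp, Real.negMulLog, neg_mul]
    have hpq : ∀ c, p c ≤ q (ψ c) := by
      intro c
      rw [hq]
      exact Finset.single_le_sum (f := p) (fun i _ => hp0 i) (by simp)
    have hlt : p c₁ < q (ψ c₁) := by
      have : p c₁ + p c₂ ≤ q (ψ c₁) := by
        rw [hq, ← Finset.sum_pair hne]
        refine Finset.sum_le_sum_of_subset_of_nonneg ?_ (fun i _ _ => hp0 i)
        intro c hc
        rcases Finset.mem_insert.1 hc with rfl | hc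
        · simp
        · rw [Finset.mem_singleton.1 hc]; simp [h12]
      linarith
    have : ∑ c, -(p c * Real.log (q (ψ c))) < ∑ c, -(p c * Real.log (p c)) := by
      refine Finset.sum_lt_sum (fun c _ => ?_) ⟨c₁, Finset.mem_univ _, ?_⟩
      · rcases (hp0 c).eq_or_lt with h | h
        · simp [← h]
        · exact neg_le_neg (mul_le_mul_of_nonneg_left (Real.log_le_log h (hpq c)) h.le)
      · exact neg_lt_neg (mul_lt_mul_of_pos_left (Real.log_lt_log hp1 hlt) hp1)
    rw [← hH1, ← hH2] at this
    exact this.ne hunif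
  refine ⟨ψ, hψd, hinj, ?_⟩
  obtain ⟨ω0⟩ : Nonempty Ω := nonempty_of_isProbabilityMeasure P
  refine ⟨fun z => if h : ∃ c, 0 < P (C ⁻¹' {c}) ∧ ψ c = z then h.choose else C ω0, ?_⟩
  intro ω hω
  have h : ∃ c, 0 < P (C ⁻¹' {c}) ∧ ψ c = g (f (C ω, S ω)) := ⟨C ω, hω, (hψd _ _).symm⟩
  simp only [dif_pos h]
  exact hinj _ _ h.choose_spec.1 hω (h.choose_spec.2.trans (hψd _ _))
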